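/- Let b ≥ 2, n ≥ 1, σ a permutation of {0,…,b−1} and Σ ∈ {σ,σ̄}^n. If b is even, then (2/b^{2n})·∑_{j=1}^n ∑_{λ=1}^{b^n} ∑_{N=1}^{b^n} φ_{b,ε_j(λ,N,Σ)}^σ(N/b^j)·φ_{b,ε_j(λ,N,Σ*)}^{σ̄}(N/b^j) = n·(Φ̃_b^σ + (1/2)Φ̃_{b,1}^σ + (1/2)Φ̃_{b,2}^σ) + (Φ̃_b^σ − (1/2)Φ̃_{b,1}^σ − (1/2)Φ̃_{b,2}^σ) − 1/36 − 1/(18·b^{2n}). If b is odd, the same quantity equals n·(Φ̃_b^σ + (1/2)Φ̃_{b,1}^σ + (1/2)Φ̃_{b,2}^σ) + (−1/36 + (b^2/(b^2−1))·(Φ̃_b^σ − (1/2)Φ̃_{b,1}^σ − (1/2)Φ̃_{b,2}^σ))·(1 − 1/b^{2n}). -/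

import Mathlib

open Finset
open scoped Classical

noncomputable section

namespace SymHamm

/-- The reversal permutation `τ(k) = b−1−k` on `{0,…,b−1}`. -/
def tauP (b : ℕ) : Equiv.Perm (Fin b) := Fin.revPerm

/-- `σ̄ = τ ∘ σ`. -/
def pbar {b : ℕ} (σ : Equiv.Perm (Fin b)) : Equiv.Perm (Fin b) := σ.trans (tauP b)

/-- Value of a permutation of `Fin b` on a natural number. -/
def permVal {b : ℕ} (σ : Equiv.Perm (Fin b)) (k : ℕ) : ℕ :=
  if h : k < b then (σ ⟨k, h⟩ : ℕ) else 0

/-- Faure's function `φ_{b,h}^σ`, extended with period 1 to all of `ℝ`.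
For `x ∈ [(k−1)/b, k/b)` (i.e. `k−1 = ⌊b·{x}⌋`), it equals
`A([0,h/b);k;Z_b^σ) − h·x` if `h ≤ σ(k−1)` and `(b−h)·x − A([h/b,1);k;Z_b^σ)` otherwise,
where `A` counts the first `k` entries `σ(0)/b,…,σ(k−1)/b` of `Z_b^σ` in the interval. -/
def phi {b : ℕ} (σ : Equiv.Perm (Fin b)) (h : ℕ) (x : ℝ) : ℝ :=
  if h ≤ permVal σ (⌊(b : ℝ) * Int.fract x⌋).toNat then
    (((Finset.range ((⌊(b : ℝ) * Int.fract x⌋).toNat + 1)).filter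
        (fun l => permVal σ l < h)).card : ℝ) - (h : ℝ) * Int.fract x
  else
    ((b : ℝ) - (h : ℝ)) * Int.fract x -
      (((Finset.range ((⌊(b : ℝ) * Int.fract x⌋).toNat + 1)).filter
        (fun l => h ≤ permVal σ l)).card : ℝ)

/-- `φ_b^σ = ∑_{h=0}^{b−1} φ_{b,h}^σ`. -/
def phiS {b : ℕ} (σ : Equiv.Perm (Fin b)) (x : ℝ) : ℝ := ∑ h ∈ range b, phi σ h x

/-- `φ_b^{σ,(2)} = ∑_{h=0}^{b−1} (φ_{b,h}^σ)²`. -/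
def phiS2 {b : ℕ} (σ : Equiv.Perm (Fin b)) (x : ℝ) : ℝ := ∑ h ∈ range b, (phi σ h x) ^ 2

/-- `φ̃_b^σ = ∑_{h=0}^{b−1} φ_{b,h}^σ · φ_{b,h}^{σ̄}`. -/
def phiT {b : ℕ} (σ : Equiv.Perm (Fin b)) (x : ℝ) : ℝ :=
  ∑ h ∈ range b, phi σ h x * phi (pbar σ) h x

/-- `φ̃_{b,1}^σ = ∑_{h=0}^{b−2} φ_{b,h+1}^σ · φ_{b,h}^{σ̄}`. -/
def phiT1 {b : ℕ} (σ : Equiv.Perm (Fin b)) (x : ℝ) : ℝ :=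
  ∑ h ∈ range (b - 1), phi σ (h + 1) x * phi (pbar σ) h x

/-- `φ̃_{b,2}^σ = ∑_{h=0}^{b−2} φ_{b,h}^σ · φ_{b,h+1}^{σ̄}`. -/
def phiT2 {b : ℕ} (σ : Equiv.Perm (Fin b)) (x : ℝ) : ℝ :=
  ∑ h ∈ range (b - 1), phi σ h x * phi (pbar σ) (h + 1) x

/-- `Φ_b^σ = (1/b)·∫_0^1 φ_b^σ`. -/
def PhiS {b : ℕ} (σ : Equiv.Perm (Fin b)) : ℝ := (1 / (b : ℝ)) * ∫ x in (0:ℝ)..1, phiS σ x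

/-- `Φ_b^{σ,(2)} = (1/b)·∫_0^1 φ_b^{σ,(2)}`. -/
def PhiS2 {b : ℕ} (σ : Equiv.Perm (Fin b)) : ℝ := (1 / (b : ℝ)) * ∫ x in (0:ℝ)..1, phiS2 σ x

/-- `Φ̃_b^σ = (1/b)·∫_0^1 φ̃_b^σ`. -/
def PhiT {b : ℕ} (σ : Equiv.Perm (Fin b)) : ℝ := (1 / (b : ℝ)) * ∫ x in (0:ℝ)..1, phiT σ x

/-- `Φ̃_{b,1}^σ = (1/b)·∫_0^1 φ̃_{b,1}^σ`. -/
def PhiT1 {b : ℕ} (σ : Equiv.Perm (Fin b)) : ℝ := (1 / (b : ℝ)) * ∫ x in (0:ℝ)..1, phiT1 σ x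

/-- `Φ̃_{b,2}^σ = (1/b)·∫_0^1 φ̃_{b,2}^σ`. -/
def PhiT2 {b : ℕ} (σ : Equiv.Perm (Fin b)) : ℝ := (1 / (b : ℝ)) * ∫ x in (0:ℝ)..1, phiT2 σ x

/-- `ν_j(N,Σ) = σ_j(N_j)·b^{n−j−1} + … + σ_{n−1}(N_{n−1})`, where `N_i` is the `i`-th
`b`-adic digit of `N`. -/
def nu (b n : ℕ) (S : Fin n → Equiv.Perm (Fin b)) (N j : ℕ) : ℕ :=
  ∑ i : Fin n,
    if j ≤ (i : ℕ) then permVal (S i) ((N / b ^ (i : ℕ)) % b) * b ^ (n - 1 - (i : ℕ)) else 0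

/-- `ε_j(λ,N,Σ)`, for `1 ≤ j ≤ n`: it is `0` when `λ = bⁿ` or `N = bⁿ`; it is the last digit
`λ_n = λ % b` when `j = n`; otherwise, with `Λ_{j−1} = λ % b^{n−j+1}` and `ν_j = ν_j(N,Σ)`,
it is `0` if `Λ_{j−1} ≤ ν_j`, it is `h` if `ν_j + (h−1)b^{n−j} < Λ_{j−1} ≤ ν_j + h·b^{n−j}`
for some `1 ≤ h < b`, and `0` if `ν_j + (b−1)b^{n−j} < Λ_{j−1} < b^{n−j+1}`. -/
def eps (b n : ℕ) (S : Fin n → Equiv.Perm (Fin b)) (lam N j : ℕ) : ℕ :=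
  if lam = b ^ n ∨ N = b ^ n then 0
  else if j = n then lam % b
  else if lam % b ^ (n - j + 1) ≤ nu b n S N j then 0
  else ((lam % b ^ (n - j + 1) - nu b n S N j - 1) / b ^ (n - j) + 1) % b

/-- The point of the digit-scrambled Hammersley point set `R_{b,n}^Σ` with digits `a`:
`(∑_{j=0}^{n−1} σ_j(a_j)/b^{n−j}, ∑_{j=0}^{n−1} a_j/b^{j+1})`. -/
def hammPt (b n : ℕ) (S : Fin n → Equiv.Perm (Fin b)) (a : Fin n → Fin b) : ℝ × ℝ :=
  (∑ j : Fin n, ((S j (a j) : ℕ) : ℝ) / (b : ℝ) ^ (n - (j : ℕ)),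
   ∑ j : Fin n, ((a j : ℕ) : ℝ) / (b : ℝ) ^ ((j : ℕ) + 1))

/-- The symmetrized Hammersley point set `R_{b,n}^{Σ,sym} = R_{b,n}^Σ ∪ R_{b,n}^{Σ*}`,
a family of `2·bⁿ` points. -/
def symFam (b n : ℕ) (S : Fin n → Equiv.Perm (Fin b)) :
    Bool × (Fin n → Fin b) → ℝ × ℝ :=
  fun p => if p.1 then hammPt b n S p.2 else hammPt b n (fun i => pbar (S i)) p.2

/-- Local discrepancy `E(x,y,P) = #{i : P i ∈ [0,x)×[0,y)} − N·x·y` of a finite family of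
points, where `N` is the number of points. -/
def localDisc {ι : Type} [Fintype ι] (P : ι → ℝ × ℝ) (x y : ℝ) : ℝ :=
  ((Finset.univ.filter
      (fun i => 0 ≤ (P i).1 ∧ (P i).1 < x ∧ 0 ≤ (P i).2 ∧ (P i).2 < y)).card : ℝ)
    - (Fintype.card ι : ℝ) * x * y

/-- `L_2` discrepancy `L2(P) = (1/N)·(∫_0^1∫_0^1 E(x,y,P)² dx dy)^{1/2}`. -/
def L2disc {ι : Type} [Fintype ι] (P : ι → ℝ × ℝ) : ℝ :=
  (1 / (Fintype.card ι : ℝ)) *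
    Real.sqrt (∫ x in (0:ℝ)..1, ∫ y in (0:ℝ)..1, (localDisc P x y) ^ 2)


lemma sum_range_mul_eq {M : Type*} [AddCommMonoid M] (p q : ℕ) (f : ℕ → M) :
    ∑ i ∈ range (p * q), f i = ∑ i ∈ range p, ∑ r ∈ range q, f (i * q + r) := by
  induction p with
  | zero => simp
  | succ p ih => rw [Nat.succ_mul, sum_range_add, sum_range_succ, ih]

lemma sum_Icc_one_eq_sum_range {f : ℕ → ℝ} {n : ℕ} (h0 : f 0 = 0) (hn : f n = 0) :
    ∑ i ∈ Icc 1 n, f i = ∑ i ∈ range n, f i := by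
  have h : ∑ i ∈ range (n + 1), f i = ∑ i ∈ Icc 1 n, f i := by
    rw [Finset.range_eq_Ico, Finset.sum_eq_sum_Ico_succ_bot (Nat.succ_pos n), h0, zero_add]
    rfl
  rw [← h, sum_range_succ, hn, add_zero]

lemma permVal_lt {b : ℕ} (hb : 0 < b) (σ : Equiv.Perm (Fin b)) (k : ℕ) : permVal σ k < b := by
  unfold permVal
  split_ifs
  · exact Fin.isLt _
  · exact hb

lemma permVal_pbar {b : ℕ} (σ : Equiv.Perm (Fin b)) {k : ℕ} (hk : k < b) :
    permVal (pbar σ) k = b - 1 - permVal σ k := by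
  simp only [permVal, hk, pbar, tauP, dif_pos, Equiv.trans_apply, Fin.revPerm_apply, Fin.val_rev]
  omega

lemma sum_permVal {M : Type*} [AddCommMonoid M] {b : ℕ} (σ : Equiv.Perm (Fin b)) (G : ℕ → M) :
    ∑ k ∈ range b, G (permVal σ k) = ∑ v ∈ range b, G v := by
  rw [← Fin.sum_univ_eq_sum_range, ← Fin.sum_univ_eq_sum_range (fun v => G v),
    ← Equiv.sum_comp σ (fun v : Fin b => G v)]
  refine sum_congr rfl fun k _ => ?_
  simp [permVal]

/-- The number whose `b`-adic digits, most significant first, are the images under `s 0, s 1, …`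
of the first `k` digits of `u`, least significant first. -/
def scramble {b : ℕ} (s : ℕ → Equiv.Perm (Fin b)) (k u : ℕ) : ℕ :=
  ∑ t ∈ range k, permVal (s t) (u / b ^ t % b) * b ^ (k - 1 - t)

lemma scramble_succ {b : ℕ} (s : ℕ → Equiv.Perm (Fin b)) (k u : ℕ) :
    scramble s (k + 1) u =
      permVal (s 0) (u % b) * b ^ k + scramble (fun t => s (t + 1)) k (u / b) := by
  unfold scramble
  rw [sum_range_succ', add_comm]
  congr 1
  · simp
  · refine sum_congr rfl fun t _ => ?_
    rw [pow_succ', Nat.div_div_eq_div_mul]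
    congr 2
    omega

lemma sum_scramble {M : Type*} [AddCommMonoid M] {b : ℕ} (hb : 0 < b) (k : ℕ) :
    ∀ (s : ℕ → Equiv.Perm (Fin b)) (G : ℕ → M),
      ∑ u ∈ range (b ^ k), G (scramble s k u) = ∑ v ∈ range (b ^ k), G v := by
  induction k with
  | zero => intro s G; simp [scramble]
  | succ k ih =>
    intro s G
    rw [pow_succ, sum_range_mul_eq, mul_comm, sum_range_mul_eq, sum_comm,
      ← sum_permVal (s 0) (fun c => ∑ r ∈ range (b ^ k), G (c * b ^ k + r))]
    refine sum_congr rfl fun c hc => ?_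
    have hc := mem_range.1 hc
    rw [← ih (fun t => s (t + 1)) (fun r => G (permVal (s 0) c * b ^ k + r))]
    refine sum_congr rfl fun u _ => ?_
    rw [scramble_succ]
    have h1 : (u * b + c) % b = c := by
      rw [add_comm, Nat.add_mul_mod_self_right, Nat.mod_eq_of_lt hc]
    have h2 : (u * b + c) / b = u := by
      rw [add_comm, Nat.add_mul_div_right _ _ hb, Nat.div_eq_of_lt hc, zero_add]
    rw [h1, h2]

lemma scramble_pbar {b : ℕ} (hb : 0 < b) (k : ℕ) :
    ∀ (s : ℕ → Equiv.Perm (Fin b)) (u : ℕ),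
      scramble (fun t => pbar (s t)) k u + scramble s k u + 1 = b ^ k := by
  induction k with
  | zero => intro s u; simp [scramble]
  | succ k ih =>
    intro s u
    rw [scramble_succ, scramble_succ, permVal_pbar _ (Nat.mod_lt _ hb)]
    have h := ih (fun t => s (t + 1)) (u / b)
    have hv := permVal_lt hb (s 0) (u % b)
    obtain ⟨w, hw⟩ : ∃ w, b = permVal (s 0) (u % b) + w + 1 :=
      ⟨b - 1 - permVal (s 0) (u % b), by omega⟩
    have hw' : b - 1 - permVal (s 0) (u % b) = w := by omega
    rw [hw', pow_succ']
    calc _ = (w + permVal (s 0) (u % b)) * b ^ k +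
          (scramble (fun t => pbar (s (t + 1))) k (u / b) +
            scramble (fun t => s (t + 1)) k (u / b) + 1) := by ring
      _ = (permVal (s 0) (u % b) + w + 1) * b ^ k := by rw [h]; ring
      _ = b * b ^ k := by rw [← hw]

lemma nu_eq_scramble {b n : ℕ} (S : Fin n → Equiv.Perm (Fin b)) (s : ℕ → Equiv.Perm (Fin b))
    (hs : ∀ i : Fin n, s i = S i) (N j : ℕ) (hj : j ≤ n) :
    nu b n S N j = scramble (fun t => s (j + t)) (n - j) (N / b ^ j) := by
  have h : nu b n S N j = ∑ i ∈ range n,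
      if j ≤ i then permVal (s i) ((N / b ^ i) % b) * b ^ (n - 1 - i) else 0 := by
    rw [← Fin.sum_univ_eq_sum_range
      (fun i => if j ≤ i then permVal (s i) ((N / b ^ i) % b) * b ^ (n - 1 - i) else 0)]
    simp only [nu, hs]
  obtain ⟨k, rfl⟩ := Nat.exists_eq_add_of_le hj
  rw [h, sum_range_add, sum_eq_zero (s := range j), zero_add, Nat.add_sub_cancel_left]
  · refine sum_congr rfl fun t ht => ?_
    rw [if_pos (Nat.le_add_right j t), pow_add, Nat.div_div_eq_div_mul]
    congr 2
    omega
  · intro i hi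
    rw [if_neg (by simpa using hi)]

/-- The number of `v < b` with `v < p` and `b - 1 - v < q` is `p + q - b`. -/
lemma sum_indicator_inter {b p q : ℕ} (hp : p ≤ b) (hq : q ≤ b) :
    ∑ v ∈ range b, (if v < p then (1 : ℝ) else 0) * (if b - 1 - v < q then 1 else 0) =
      ((p + q - b : ℕ) : ℝ) := by
  have h : ∀ v ∈ range b, (if v < p then (1 : ℝ) else 0) * (if b - 1 - v < q then 1 else 0) =
      if v ∈ Ico (b - q) p then 1 else 0 := by
    intro v hv
    have := mem_range.1 hv
    have hiff : v ∈ Ico (b - q) p ↔ v < p ∧ b - 1 - v < q := by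
      rw [mem_Ico]
      omega
    rw [if_congr hiff rfl rfl, ite_and]
    split_ifs <;> simp
  rw [sum_congr rfl h, sum_ite_mem, inter_eq_right.2]
  · simp only [sum_const, Nat.card_Ico, nsmul_eq_mul, mul_one]
    congr 1
    omega
  · intro v hv
    rw [mem_Ico] at hv
    rw [mem_range]
    omega

lemma sum_indicator_lt {b p : ℕ} (hp : p ≤ b) :
    ∑ v ∈ range b, (if v < p then (1 : ℝ) else 0) = p := by
  have h := sum_indicator_inter hp le_rfl
  rw [Nat.add_sub_cancel] at h
  rw [← h]
  refine sum_congr rfl fun v hv => ?_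
  have := mem_range.1 hv
  rw [if_pos (by omega : b - 1 - v < b), mul_one]

lemma sum_indicator_rev_lt {b p : ℕ} (hp : p ≤ b) :
    ∑ v ∈ range b, (if b - 1 - v < p then (1 : ℝ) else 0) = p := by
  rw [sum_range_reflect (fun v => if v < p then (1 : ℝ) else 0), sum_indicator_lt hp]

/-- The sum `∑_{h<B} max(0, 2h - B)`. -/
def hingeSum (B : ℕ) : ℝ := ∑ h ∈ range B, ((2 * h - B : ℕ) : ℝ)

lemma hingeSum_add_two (B : ℕ) : hingeSum (B + 2) = hingeSum B + B := by
  unfold hingeSum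
  rw [sum_range_succ', sum_range_succ]
  have : ∀ h, 2 * (h + 1) - (B + 2) = 2 * h - B := fun h => by omega
  simp only [this]
  rw [show 2 * B - B = B by omega, show 2 * 0 - (B + 2) = 0 by omega, Nat.cast_zero, add_zero]

lemma hingeSum_even (m : ℕ) : hingeSum (2 * m) = (m : ℝ) ^ 2 - m := by
  induction m with
  | zero => simp [hingeSum]
  | succ m ih =>
    rw [mul_add, mul_one, hingeSum_add_two, ih]
    push_cast
    ring

lemma hingeSum_odd (m : ℕ) : hingeSum (2 * m + 1) = (m : ℝ) ^ 2 := by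
  induction m with
  | zero => simp [hingeSum]
  | succ m ih =>
    rw [show 2 * (m + 1) + 1 = 2 * m + 1 + 2 by ring, hingeSum_add_two, ih]
    push_cast
    ring

lemma sum_hinge_succ (B : ℕ) :
    ∑ h ∈ range B, ((2 * h + 1 - B : ℕ) : ℝ) = B * (B - 1) / 2 - hingeSum B := by
  have h : ∑ h ∈ range B, ((2 * h + 1 - B : ℕ) : ℝ) + hingeSum B = B * (B - 1) / 2 := by
    rw [hingeSum, ← sum_add_distrib]
    induction B using Nat.twoStepInduction with
    | zero => simp
    | one => simp
    | more B ih _ =>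
      rw [sum_range_succ', sum_range_succ]
      have h1 : ∀ h, 2 * (h + 1) - (B + 2) = 2 * h - B := fun h => by omega
      have h2 : ∀ h, 2 * (h + 1) + 1 - (B + 2) = 2 * h + 1 - B := fun h => by omega
      simp only [h1, h2, ih]
      rw [show 2 * B - B = B by omega, show 2 * 0 - (B + 2) = 0 by omega,
        show 2 * B + 1 - B = B + 1 by omega, show 2 * 0 + 1 - (B + 2) = 0 by omega]
      push_cast
      ring
  linarith

lemma sum_sum_mul_carry {B : ℕ} (f g : ℕ → ℝ) (c : ℕ) :
    ∑ d ∈ range B, ∑ v ∈ range B,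
        f ((c * B + d + (B - 1 - v)) / B) * g ((c * B + d + v) / B) =
      (B + hingeSum B) * (f c * g c) +
        (B * (B - 1) / 2 - hingeSum B) * (f (c + 1) * g c + f c * g (c + 1)) +
        hingeSum B * (f (c + 1) * g (c + 1)) := by
  have key : ∀ d ∈ range B, ∑ v ∈ range B,
        f ((c * B + d + (B - 1 - v)) / B) * g ((c * B + d + v) / B) =
      B * (f c * g c) + d * ((f (c + 1) - f c) * g c) + d * (f c * (g (c + 1) - g c)) +
        ((2 * d - B : ℕ) : ℝ) * ((f (c + 1) - f c) * (g (c + 1) - g c)) := by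
    intro d hd
    have hd := mem_range.1 hd
    have h : ∀ v ∈ range B, f ((c * B + d + (B - 1 - v)) / B) * g ((c * B + d + v) / B) =
        f c * g c + (if v < d then (1 : ℝ) else 0) * ((f (c + 1) - f c) * g c) +
        (if B - 1 - v < d then (1 : ℝ) else 0) * (f c * (g (c + 1) - g c)) +
        ((if v < d then (1 : ℝ) else 0) * (if B - 1 - v < d then 1 else 0)) *
          ((f (c + 1) - f c) * (g (c + 1) - g c)) := by
      intro v hv
      have hv := mem_range.1 hv
      have h1 : (c * B + d + (B - 1 - v)) / B = if v < d then c + 1 else c := by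
        split_ifs with h
        · exact Nat.div_eq_of_lt_le (by rw [add_mul]; omega) (by rw [add_mul, add_mul]; omega)
        · exact Nat.div_eq_of_lt_le (by omega) (by rw [add_mul]; omega)
      have h2 : (c * B + d + v) / B = if B - 1 - v < d then c + 1 else c := by
        split_ifs with h
        · exact Nat.div_eq_of_lt_le (by rw [add_mul]; omega) (by rw [add_mul, add_mul]; omega)
        · exact Nat.div_eq_of_lt_le (by omega) (by rw [add_mul]; omega)
      rw [h1, h2]
      split_ifs <;> ring
    rw [sum_congr rfl h]
    simp only [sum_add_distrib, ← sum_mul, sum_indicator_lt hd.le, sum_indicator_rev_lt hd.le,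
      sum_indicator_inter hd.le hd.le, sum_const, card_range, nsmul_eq_mul]
    rw [two_mul, mul_assoc]
  have hG : ∑ d ∈ range B, (d : ℝ) = B * (B - 1) / 2 := by
    clear key
    induction B with
    | zero => simp
    | succ B ih => rw [sum_range_succ, ih]; push_cast; ring
  rw [sum_congr rfl key]
  simp only [sum_add_distrib, ← sum_mul, hG, sum_const, card_range, nsmul_eq_mul]
  rw [show ∑ h ∈ range B, ((2 * h - B : ℕ) : ℝ) = hingeSum B from rfl]
  ring

lemma sum_carry {b B : ℕ} (f g : ℕ → ℝ) (hf0 : f 0 = 0) (hfb : f b = 0) :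
    ∑ L ∈ range (b * B), ∑ v ∈ range B, f ((L + (B - 1 - v)) / B) * g ((L + v) / B) =
      (B + 2 * hingeSum B) * ∑ h ∈ range b, f h * g h +
        (B * (B - 1) / 2 - hingeSum B) *
          (∑ h ∈ range b, f (h + 1) * g h + ∑ h ∈ range b, f h * g (h + 1)) := by
  have hs : ∑ h ∈ range b, f (h + 1) * g (h + 1) = ∑ h ∈ range b, f h * g h := by
    have h1 := sum_range_succ' (fun h => f h * g h) b
    rw [sum_range_succ, hf0, hfb] at h1
    linarith
  rw [sum_range_mul_eq, sum_congr rfl fun c _ => sum_sum_mul_carry f g c]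
  simp only [sum_add_distrib, ← mul_sum, hs]
  ring

lemma phi_zero {b : ℕ} (σ : Equiv.Perm (Fin b)) (x : ℝ) : phi σ 0 x = 0 := by
  simp [phi]

lemma phi_self {b : ℕ} (hb : 0 < b) (σ : Equiv.Perm (Fin b)) (x : ℝ) : phi σ b x = 0 := by
  simp [phi, fun k => not_le.2 (permVal_lt hb σ k)]

lemma phi_nat_add {b : ℕ} (σ : Equiv.Perm (Fin b)) (h u : ℕ) (x : ℝ) :
    phi σ h (u + x) = phi σ h x := by
  simp only [phi, Int.fract_natCast_add]

lemma phi_mod {b : ℕ} (hb : 0 < b) (σ : Equiv.Perm (Fin b)) {e : ℕ} (he : e ≤ b) (x : ℝ) :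
    phi σ (e % b) x = phi σ e x := by
  rcases he.lt_or_eq with h | rfl
  · rw [Nat.mod_eq_of_lt h]
  · rw [Nat.mod_self, phi_zero, phi_self hb]

/-- The value of `φ_{b,h}^σ` at `k / b`. -/
def phiNode {b : ℕ} (σ : Equiv.Perm (Fin b)) (h k : ℕ) : ℝ :=
  ∑ l ∈ range k, (if permVal σ l < h then (1 : ℝ) else 0) - h * k / b

/-- The slope of `φ_{b,h}^σ` on `[k / b, (k + 1) / b)`, where `v = σ(k)`. -/
def phiSlope (b h v : ℕ) : ℝ := (if v < h then (b : ℝ) else 0) - h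

lemma phiNode_zero {b : ℕ} (σ : Equiv.Perm (Fin b)) (h : ℕ) : phiNode σ h 0 = 0 := by
  simp [phiNode]

lemma phiNode_self {b : ℕ} (hb : 0 < b) (σ : Equiv.Perm (Fin b)) {h : ℕ} (hh : h ≤ b) :
    phiNode σ h b = 0 := by
  have hb' : (b : ℝ) ≠ 0 := by positivity
  rw [phiNode, sum_permVal σ (fun v => if v < h then (1 : ℝ) else 0), sum_indicator_lt hh,
    mul_div_cancel_right₀ _ hb', sub_self]

lemma phiNode_succ {b : ℕ} (hb : 0 < b) (σ : Equiv.Perm (Fin b)) (h k : ℕ) :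
    phiNode σ h (k + 1) = phiNode σ h k + phiSlope b h (permVal σ k) * (1 / b) := by
  have hb' : (b : ℝ) ≠ 0 := by positivity
  rw [phiNode, phiNode, sum_range_succ, phiSlope]
  split_ifs <;> field_simp <;> push_cast <;> ring

lemma phi_eq_affine {b : ℕ} (hb : 0 < b) (σ : Equiv.Perm (Fin b)) (h : ℕ) {k : ℕ} (hk : k < b)
    {t : ℝ} (ht0 : 0 ≤ t) (ht1 : t < 1 / b) :
    phi σ h (k / b + t) = phiNode σ h k + phiSlope b h (permVal σ k) * t := by
  have hb' : (0 : ℝ) < b := by exact_mod_cast hb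
  have hkb : (k : ℝ) + 1 ≤ b := by exact_mod_cast hk
  have htb : b * t < 1 := by rwa [lt_div_iff₀' hb'] at ht1
  have hx : (b : ℝ) * (k / b + t) = k + b * t := by field_simp
  have hfract : Int.fract ((k : ℝ) / b + t) = k / b + t := by
    rw [Int.fract_eq_self]
    refine ⟨by positivity, ?_⟩
    refine lt_of_mul_lt_mul_left ?_ hb'.le
    rw [hx]
    linarith
  have hfloor : ⌊(b : ℝ) * (k / b + t)⌋ = k := by
    rw [Int.floor_eq_iff, hx]
    constructor
    · push_cast
      have : 0 ≤ b * t := by positivity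
      linarith
    · push_cast
      linarith
  have hcard : ∀ m : ℕ, (((range m).filter (fun l => permVal σ l < h)).card : ℝ) =
      ∑ l ∈ range m, (if permVal σ l < h then (1 : ℝ) else 0) := fun m => by
    rw [sum_boole]
  have hcard' : ∀ m : ℕ, (((range m).filter (fun l => h ≤ permVal σ l)).card : ℝ) =
      m - ∑ l ∈ range m, (if permVal σ l < h then (1 : ℝ) else 0) := fun m => by
    rw [← hcard, eq_sub_iff_add_eq, ← Nat.cast_add, add_comm]
    simp only [← not_lt]
    rw [card_filter_add_card_filter_not, card_range]
  rw [phi, hfract, hfloor, Int.toNat_natCast, hcard, hcard', sum_range_succ, phiNode, phiSlope]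
  by_cases hh : h ≤ permVal σ k
  · rw [if_pos hh, if_neg (not_lt.2 hh), if_neg (not_lt.2 hh)]
    field_simp
    ring
  · rw [if_neg hh, if_pos (not_le.1 hh), if_pos (not_le.1 hh)]
    push_cast
    field_simp
    ring

lemma phi_apply_zero {b : ℕ} (hb : 0 < b) (σ : Equiv.Perm (Fin b)) (h : ℕ) : phi σ h 0 = 0 := by
  have := phi_eq_affine hb σ h hb le_rfl (by positivity : (0 : ℝ) < 1 / b)
  simpa [phiNode_zero] using this

lemma phi_mul_phi_eqOn {b : ℕ} (hb : 0 < b) (σ ρ : Equiv.Perm (Fin b)) (h h' : ℕ) {k : ℕ}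
    (hk : k < b) :
    Set.EqOn (fun x : ℝ => (phiNode σ h k + phiSlope b h (permVal σ k) * (x - k / b)) *
        (phiNode ρ h' k + phiSlope b h' (permVal ρ k) * (x - k / b)))
      (fun x => phi σ h x * phi ρ h' x) (Set.uIoo ((k : ℝ) / b) (((k + 1 : ℕ) : ℝ) / b)) := by
  have hb' : (0 : ℝ) < b := by exact_mod_cast hb
  intro x hx
  have hle : (k : ℝ) / b ≤ ((k + 1 : ℕ) : ℝ) / b := by gcongr; exact k.le_succ
  rw [Set.uIoo_of_le hle] at hx
  have h0 : 0 ≤ x - k / b := by linarith [hx.1]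
  have h1 : x - k / b < 1 / b := by
    have := hx.2
    push_cast at this
    rw [add_div] at this
    linarith
  have e1 := phi_eq_affine hb σ h hk h0 h1
  have e2 := phi_eq_affine hb ρ h' hk h0 h1
  rw [add_sub_cancel] at e1 e2
  simp only [e1, e2]

lemma intervalIntegrable_phi_mul_phi_piece {b : ℕ} (hb : 0 < b) (σ ρ : Equiv.Perm (Fin b))
    (h h' : ℕ) {k : ℕ} (hk : k < b) :
    IntervalIntegrable (fun x => phi σ h x * phi ρ h' x) MeasureTheory.volume
      ((k : ℝ) / b) (((k + 1 : ℕ) : ℝ) / b) :=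
  IntervalIntegrable.congr_uIoo (Continuous.intervalIntegrable (by fun_prop) _ _)
    (phi_mul_phi_eqOn hb σ ρ h h' hk)

lemma intervalIntegrable_phi_mul_phi {b : ℕ} (hb : 0 < b) (σ ρ : Equiv.Perm (Fin b)) (h h' : ℕ) :
    IntervalIntegrable (fun x => phi σ h x * phi ρ h' x) MeasureTheory.volume 0 1 := by
  have hb' : (b : ℝ) ≠ 0 := by positivity
  have := IntervalIntegrable.trans_iterate (a := fun k : ℕ => (k : ℝ) / b) (n := b)
    fun k hk => intervalIntegrable_phi_mul_phi_piece hb σ ρ h h' hk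
  simpa [hb'] using this

lemma integral_affine_mul_affine (p q s r c d : ℝ) :
    ∫ x in c..(c + d), (p + s * (x - c)) * (q + r * (x - c)) =
      p * q * d + (p * r + s * q) * d ^ 2 / 2 + s * r * d ^ 3 / 3 := by
  have hd : ∀ x : ℝ, HasDerivAt
      (fun x => p * q * (x - c) + (p * r + s * q) * (x - c) ^ 2 / 2 + s * r * (x - c) ^ 3 / 3)
      ((p + s * (x - c)) * (q + r * (x - c))) x := by
    intro x
    have h1 : HasDerivAt (fun x : ℝ => x - c) 1 x := (hasDerivAt_id x).sub_const c
    have := ((h1.const_mul (p * q)).add (((h1.pow 2).const_mul (p * r + s * q)).div_const 2)).add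
      (((h1.pow 3).const_mul (s * r)).div_const 3)
    exact this.congr_deriv (by push_cast; ring)
  rw [intervalIntegral.integral_eq_sub_of_hasDerivAt (fun x _ => hd x)
    (Continuous.intervalIntegrable (by fun_prop) _ _)]
  simp only [add_sub_cancel_left, sub_self]
  ring

lemma sum_affine_mul_affine (p q s r d : ℝ) (m : ℕ) :
    ∑ i ∈ range m, (p + s * (i * d)) * (q + r * (i * d)) =
      p * q * m + (p * r + s * q) * d * (m * (m - 1) / 2) +
        s * r * d ^ 2 * (m * (m - 1) * (2 * m - 1) / 6) := by
  induction m with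
  | zero => simp
  | succ m ih => rw [sum_range_succ, ih]; push_cast; ring

/-- The trapezoidal rule for a product of two continuous piecewise affine functions. -/
lemma sum_phi_mul_phi {b : ℕ} (hb : 0 < b) (σ ρ : Equiv.Perm (Fin b)) {h h' : ℕ} (hh : h ≤ b)
    {m : ℕ} (hm : 0 < m) :
    ∑ M ∈ range (b * m), phi σ h ((M : ℝ) / (b * m)) * phi ρ h' ((M : ℝ) / (b * m)) =
      b * m * (∫ x in (0 : ℝ)..1, phi σ h x * phi ρ h' x) +
        1 / (6 * b ^ 2 * m) *
          ∑ k ∈ range b, phiSlope b h (permVal σ k) * phiSlope b h' (permVal ρ k) := by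
  have hb' : (b : ℝ) ≠ 0 := by positivity
  have hm' : (m : ℝ) ≠ 0 := by positivity
  have hint := intervalIntegral.sum_integral_adjacent_intervals
    (a := fun k : ℕ => (k : ℝ) / b) (n := b)
    fun k hk => intervalIntegrable_phi_mul_phi_piece hb σ ρ h h' hk
  simp only [Nat.cast_zero, zero_div, div_self hb'] at hint
  have htel := sum_range_sub (fun k => phiNode σ h k * phiNode ρ h' k) b
  rw [phiNode_self hb σ hh, phiNode_zero, zero_mul, zero_mul, sub_zero] at htel
  have hpiece : ∀ k ∈ range b, ∑ r ∈ range m,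
      phi σ h (((k * m + r : ℕ) : ℝ) / (b * m)) * phi ρ h' (((k * m + r : ℕ) : ℝ) / (b * m)) =
      b * m * (∫ x in ((k : ℝ) / b)..(((k + 1 : ℕ) : ℝ) / b), phi σ h x * phi ρ h' x) +
        1 / (6 * b ^ 2 * m) * (phiSlope b h (permVal σ k) * phiSlope b h' (permVal ρ k)) -
        1 / 2 * (phiNode σ h (k + 1) * phiNode ρ h' (k + 1) - phiNode σ h k * phiNode ρ h' k) := by
    intro k hk
    have hk := mem_range.1 hk
    have hval : ∀ r ∈ range m,
        phi σ h (((k * m + r : ℕ) : ℝ) / (b * m)) * phi ρ h' (((k * m + r : ℕ) : ℝ) / (b * m)) =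
        (phiNode σ h k + phiSlope b h (permVal σ k) * (r * (1 / (b * m)))) *
        (phiNode ρ h' k + phiSlope b h' (permVal ρ k) * (r * (1 / (b * m)))) := by
      intro r hr
      have hr : (r : ℝ) < m := by exact_mod_cast mem_range.1 hr
      have hx : ((k * m + r : ℕ) : ℝ) / (b * m) = k / b + r * (1 / (b * m)) := by
        push_cast
        field_simp
      have h0 : (0 : ℝ) ≤ r * (1 / (b * m)) := by positivity
      have h1 : (r : ℝ) * (1 / (b * m)) < 1 / b := by
        rw [mul_one_div, div_lt_div_iff₀ (by positivity) (by positivity), one_mul, mul_comm]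
        have : (0 : ℝ) < b := by positivity
        gcongr
      rw [hx, phi_eq_affine hb σ h hk h0 h1, phi_eq_affine hb ρ h' hk h0 h1]
    rw [sum_congr rfl hval, sum_affine_mul_affine,
      ← intervalIntegral.integral_congr_uIoo (phi_mul_phi_eqOn hb σ ρ h h' hk),
      show ((k + 1 : ℕ) : ℝ) / b = k / b + 1 / b by push_cast; ring,
      integral_affine_mul_affine, phiNode_succ hb, phiNode_succ hb]
    field_simp
    ring
  rw [sum_range_mul_eq, sum_congr rfl hpiece, sum_sub_distrib, sum_add_distrib, ← mul_sum,
    ← mul_sum, ← mul_sum, hint, htel]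
  ring

lemma sum_phiSlope_mul_pbar {b : ℕ} (σ : Equiv.Perm (Fin b)) {p q : ℕ}
    (hp : p ≤ b) (hq : q ≤ b) :
    ∑ k ∈ range b, phiSlope b p (permVal σ k) * phiSlope b q (permVal (pbar σ) k) =
      (b : ℝ) ^ 2 * ((p + q - b : ℕ) : ℝ) - b * (p * q) := by
  have h1 : ∀ k ∈ range b, phiSlope b p (permVal σ k) * phiSlope b q (permVal (pbar σ) k) =
      phiSlope b p (permVal σ k) * phiSlope b q (b - 1 - permVal σ k) := fun k hk => by
    rw [permVal_pbar σ (mem_range.1 hk)]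
  rw [sum_congr rfl h1, sum_permVal σ (fun v => phiSlope b p v * phiSlope b q (b - 1 - v))]
  have h2 : ∀ v ∈ range b, phiSlope b p v * phiSlope b q (b - 1 - v) =
      (b : ℝ) ^ 2 * ((if v < p then 1 else 0) * (if b - 1 - v < q then 1 else 0)) -
        b * q * (if v < p then 1 else 0) - b * p * (if b - 1 - v < q then 1 else 0) + p * q := by
    intro v _
    unfold phiSlope
    split_ifs <;> ring
  rw [sum_congr rfl h2, sum_add_distrib, sum_sub_distrib, sum_sub_distrib, ← mul_sum, ← mul_sum,
    ← mul_sum, sum_indicator_inter hp hq, sum_indicator_lt hp, sum_indicator_rev_lt hq, sum_const,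
    card_range, nsmul_eq_mul]
  ring

lemma sum_sum_phi_mul_phi_pbar {b : ℕ} (hb : 0 < b) (σ : Equiv.Perm (Fin b)) {p q : ℕ → ℕ}
    (hp : ∀ h < b, p h ≤ b) (hq : ∀ h < b, q h ≤ b) {m : ℕ} (hm : 0 < m) :
    ∑ M ∈ range (b * m), ∑ h ∈ range b,
        phi σ (p h) ((M : ℝ) / (b * m)) * phi (pbar σ) (q h) ((M : ℝ) / (b * m)) =
      b * m * (∫ x in (0 : ℝ)..1, ∑ h ∈ range b, phi σ (p h) x * phi (pbar σ) (q h) x) +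
        1 / (6 * b ^ 2 * m) * ((b : ℝ) ^ 2 * (∑ h ∈ range b, ((p h + q h - b : ℕ) : ℝ)) -
          b * ∑ h ∈ range b, (p h : ℝ) * q h) := by
  rw [sum_comm, intervalIntegral.integral_finsetSum
    fun h _ => intervalIntegrable_phi_mul_phi hb σ (pbar σ) (p h) (q h),
    mul_sum _ _ ((b : ℝ) * m), mul_sum _ _ ((b : ℝ) ^ 2), mul_sum _ _ (b : ℝ), ← sum_sub_distrib,
    mul_sum, ← sum_add_distrib]
  refine sum_congr rfl fun h hh => ?_
  have hh := mem_range.1 hh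
  rw [sum_phi_mul_phi hb σ (pbar σ) (hp h hh) hm,
    sum_phiSlope_mul_pbar σ (hp h hh) (hq h hh)]

lemma phiT1_eq {b : ℕ} (hb : 0 < b) (σ : Equiv.Perm (Fin b)) (x : ℝ) :
    phiT1 σ x = ∑ h ∈ range b, phi σ (h + 1) x * phi (pbar σ) h x := by
  obtain ⟨c, rfl⟩ : ∃ c, b = c + 1 := ⟨b - 1, by omega⟩
  rw [sum_range_succ, phi_self hb, zero_mul, add_zero]
  rfl

lemma phiT2_eq {b : ℕ} (hb : 0 < b) (σ : Equiv.Perm (Fin b)) (x : ℝ) :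
    phiT2 σ x = ∑ h ∈ range b, phi σ h x * phi (pbar σ) (h + 1) x := by
  obtain ⟨c, rfl⟩ : ∃ c, b = c + 1 := ⟨b - 1, by omega⟩
  rw [sum_range_succ, phi_self hb, mul_zero, add_zero]
  rfl

lemma sum_range_sq (b : ℕ) :
    ∑ h ∈ range b, (h : ℝ) * h = b * (b - 1) * (2 * b - 1) / 6 := by
  induction b with
  | zero => simp
  | succ b ih => rw [sum_range_succ, ih]; push_cast; ring

lemma sum_range_mul_succ (b : ℕ) :
    ∑ h ∈ range b, (h : ℝ) * (h + 1) = b * (b - 1) * (b + 1) / 3 := by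
  induction b with
  | zero => simp
  | succ b ih => rw [sum_range_succ, ih]; push_cast; ring

lemma sum_phiT {b : ℕ} (hb : 0 < b) (σ : Equiv.Perm (Fin b)) {m : ℕ} (hm : 0 < m) :
    ∑ M ∈ range (b * m), phiT σ ((M : ℝ) / (b * m)) =
      (b : ℝ) ^ 2 * m * PhiT σ +
        1 / (6 * m) * (hingeSum b - (b - 1) * (2 * b - 1) / 6) := by
  have hb' : (b : ℝ) ≠ 0 := by positivity
  have hm' : (m : ℝ) ≠ 0 := by positivity
  have h := sum_sum_phi_mul_phi_pbar hb σ (p := fun h => h) (q := fun h => h)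
    (fun h hh => hh.le) (fun h hh => hh.le) hm
  simp only [← two_mul, sum_range_sq] at h
  rw [show ∑ h ∈ range b, ((2 * h - b : ℕ) : ℝ) = hingeSum b from rfl] at h
  simp only [PhiT, phiT, h]
  field_simp

lemma sum_phiT1 {b : ℕ} (hb : 0 < b) (σ : Equiv.Perm (Fin b)) {m : ℕ} (hm : 0 < m) :
    ∑ M ∈ range (b * m), phiT1 σ ((M : ℝ) / (b * m)) =
      (b : ℝ) ^ 2 * m * PhiT1 σ +
        1 / (6 * m) * (b * (b - 1) / 2 - hingeSum b - (b - 1) * (b + 1) / 3) := by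
  have hb' : (b : ℝ) ≠ 0 := by positivity
  have hm' : (m : ℝ) ≠ 0 := by positivity
  have h := sum_sum_phi_mul_phi_pbar hb σ (p := fun h => h + 1) (q := fun h => h)
    (fun h hh => hh) (fun h hh => hh.le) hm
  have e1 : ∀ h, h + 1 + h - b = 2 * h + 1 - b := fun h => by omega
  simp only [e1, sum_hinge_succ, Nat.cast_succ, mul_comm ((_ : ℝ) + 1) _, sum_range_mul_succ] at h
  simp only [PhiT1, phiT1_eq hb, h]
  field_simp

lemma sum_phiT2 {b : ℕ} (hb : 0 < b) (σ : Equiv.Perm (Fin b)) {m : ℕ} (hm : 0 < m) :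
    ∑ M ∈ range (b * m), phiT2 σ ((M : ℝ) / (b * m)) =
      (b : ℝ) ^ 2 * m * PhiT2 σ +
        1 / (6 * m) * (b * (b - 1) / 2 - hingeSum b - (b - 1) * (b + 1) / 3) := by
  have hb' : (b : ℝ) ≠ 0 := by positivity
  have hm' : (m : ℝ) ≠ 0 := by positivity
  have h := sum_sum_phi_mul_phi_pbar hb σ (p := fun h => h) (q := fun h => h + 1)
    (fun h hh => hh.le) (fun h hh => hh) hm
  have e1 : ∀ h, h + (h + 1) - b = 2 * h + 1 - b := fun h => by omega
  simp only [e1, sum_hinge_succ, Nat.cast_succ, sum_range_mul_succ] at h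
  simp only [PhiT2, phiT2_eq hb, h]
  field_simp

lemma phi_eps {b n j : ℕ} (hb : 0 < b) (hj : j ≤ n) (ρ : Equiv.Perm (Fin b))
    (S : Fin n → Equiv.Perm (Fin b)) {lam N v : ℕ} (hlam : lam < b ^ n) (hN : N < b ^ n)
    (hv : v + nu b n S N j + 1 = b ^ (n - j)) (x : ℝ) :
    phi ρ (eps b n S lam N j) x =
      phi ρ ((lam % (b * b ^ (n - j)) + v) / b ^ (n - j)) x := by
  have hB : 0 < b ^ (n - j) := by positivity
  unfold eps
  rw [if_neg (by omega), pow_succ']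
  have hL : lam % (b * b ^ (n - j)) < b * b ^ (n - j) := Nat.mod_lt _ (by positivity)
  split_ifs with h1 h2
  · subst h1
    rw [Nat.sub_self, pow_zero] at hv ⊢
    rw [show v = 0 by omega, mul_one, add_zero, Nat.div_one]
  · rw [Nat.div_eq_of_lt (by omega)]
  · rw [← Nat.add_div_right _ hB]
    have e : lam % (b * b ^ (n - j)) - nu b n S N j - 1 + b ^ (n - j) =
        lam % (b * b ^ (n - j)) + v := by omega
    rw [e]
    refine phi_mod hb ρ ?_ x
    rw [← Nat.lt_succ_iff, Nat.div_lt_iff_lt_mul hB, Nat.succ_mul]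
    omega

/-- The contribution of a single digit position to the sum over all `λ` and `N`. -/
lemma sum_phi_eps {b n i : ℕ} (hb : 0 < b) (hi : i < n) (σ : Equiv.Perm (Fin b))
    (S : Fin n → Equiv.Perm (Fin b)) :
    ∑ lam ∈ Icc 1 (b ^ n), ∑ N ∈ Icc 1 (b ^ n),
        phi σ (eps b n S lam N (i + 1)) ((N : ℝ) / (b : ℝ) ^ (i + 1)) *
          phi (pbar σ) (eps b n (fun k => pbar (S k)) lam N (i + 1))
            ((N : ℝ) / (b : ℝ) ^ (i + 1)) =
      (b : ℝ) ^ i * ∑ M ∈ range (b ^ (i + 1)),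
        (((b ^ (n - (i + 1)) : ℕ) + 2 * hingeSum (b ^ (n - (i + 1)))) *
            phiT σ ((M : ℝ) / (b : ℝ) ^ (i + 1)) +
          ((b ^ (n - (i + 1)) : ℕ) * ((b ^ (n - (i + 1)) : ℕ) - 1) / 2 -
              hingeSum (b ^ (n - (i + 1)))) *
            (phiT1 σ ((M : ℝ) / (b : ℝ) ^ (i + 1)) + phiT2 σ ((M : ℝ) / (b : ℝ) ^ (i + 1)))) := by
  have hn : 0 < n := by omega
  have hb' : (b : ℝ) ≠ 0 := by positivity
  have hpos : 0 < b ^ n := by positivity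
  set s : ℕ → Equiv.Perm (Fin b) := fun k => if h : k < n then S ⟨k, h⟩ else 1 with hs
  set w : ℕ → ℕ := scramble (fun t => s (i + 1 + t)) (n - (i + 1)) with hw
  set B := b ^ (n - (i + 1)) with hBdef
  have hBpos : 0 < B := by positivity
  have hcompl : ∀ u, scramble (fun t => pbar (s (i + 1 + t))) (n - (i + 1)) u + w u + 1 = B :=
    fun u => scramble_pbar hb (n - (i + 1)) (fun t => s (i + 1 + t)) u
  have hnu : ∀ N, nu b n S N (i + 1) = w (N / b ^ (i + 1)) := fun N =>
    nu_eq_scramble S s (fun k => by simp [hs]) N (i + 1) hi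
  have hnu' : ∀ N, nu b n (fun k => pbar (S k)) N (i + 1) = B - 1 - w (N / b ^ (i + 1)) := by
    intro N
    rw [nu_eq_scramble (fun k => pbar (S k)) (fun k => pbar (s k)) (fun k => by simp [hs]) N
      (i + 1) hi]
    have := hcompl (N / b ^ (i + 1))
    omega
  have hwlt : ∀ u, w u < B := fun u => by
    have := hcompl u
    omega
  have heps0 : ∀ (S' : Fin n → Equiv.Perm (Fin b)) (N : ℕ), eps b n S' 0 N (i + 1) = 0 := by
    intro S' N
    unfold eps
    split_ifs <;> simp_all
  have hlam : ∀ lam, ∑ N ∈ Icc 1 (b ^ n),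
        phi σ (eps b n S lam N (i + 1)) ((N : ℝ) / (b : ℝ) ^ (i + 1)) *
          phi (pbar σ) (eps b n (fun k => pbar (S k)) lam N (i + 1))
            ((N : ℝ) / (b : ℝ) ^ (i + 1)) =
      ∑ N ∈ range (b ^ n),
        phi σ (eps b n S lam N (i + 1)) ((N : ℝ) / (b : ℝ) ^ (i + 1)) *
          phi (pbar σ) (eps b n (fun k => pbar (S k)) lam N (i + 1))
            ((N : ℝ) / (b : ℝ) ^ (i + 1)) := by
    intro lam
    refine sum_Icc_one_eq_sum_range ?_ ?_
    · simp [phi_apply_zero hb]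
    · simp [eps, phi_zero]
  rw [sum_congr rfl fun lam _ => hlam lam, sum_Icc_one_eq_sum_range
    (by simp [heps0, phi_zero]) (by simp [eps, phi_zero])]
  have hval : ∀ lam ∈ range (b ^ n), ∑ N ∈ range (b ^ n),
        phi σ (eps b n S lam N (i + 1)) ((N : ℝ) / (b : ℝ) ^ (i + 1)) *
          phi (pbar σ) (eps b n (fun k => pbar (S k)) lam N (i + 1))
            ((N : ℝ) / (b : ℝ) ^ (i + 1)) =
      ∑ M ∈ range (b ^ (i + 1)), ∑ v ∈ range B,
        phi σ ((lam % (b * B) + (B - 1 - v)) / B) ((M : ℝ) / (b : ℝ) ^ (i + 1)) *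
          phi (pbar σ) ((lam % (b * B) + v) / B) ((M : ℝ) / (b : ℝ) ^ (i + 1)) := by
    intro lam hl
    have hl := mem_range.1 hl
    have hpow : b ^ n = B * b ^ (i + 1) := by
      rw [hBdef, ← pow_add]
      congr 1
      omega
    have hterm : ∀ N ∈ range (b ^ n),
        phi σ (eps b n S lam N (i + 1)) ((N : ℝ) / (b : ℝ) ^ (i + 1)) *
          phi (pbar σ) (eps b n (fun k => pbar (S k)) lam N (i + 1))
            ((N : ℝ) / (b : ℝ) ^ (i + 1)) =
        phi σ ((lam % (b * B) + (B - 1 - w (N / b ^ (i + 1)))) / B)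
            ((N : ℝ) / (b : ℝ) ^ (i + 1)) *
          phi (pbar σ) ((lam % (b * B) + w (N / b ^ (i + 1))) / B)
            ((N : ℝ) / (b : ℝ) ^ (i + 1)) := by
      intro N hN
      have hN := mem_range.1 hN
      have h := hwlt (N / b ^ (i + 1))
      rw [phi_eps (j := i + 1) hb hi σ S hl hN (v := B - 1 - w (N / b ^ (i + 1))) (by rw [hnu, ← hBdef]; omega),
        phi_eps (j := i + 1) hb hi (pbar σ) _ hl hN (v := w (N / b ^ (i + 1))) (by rw [hnu', ← hBdef]; omega)]
    rw [sum_congr rfl hterm, hpow, sum_range_mul_eq, sum_comm]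
    refine sum_congr rfl fun M hM => ?_
    have hM := mem_range.1 hM
    rw [← sum_scramble hb (n - (i + 1)) (fun t => s (i + 1 + t)) (fun v =>
        phi σ ((lam % (b * B) + (B - 1 - v)) / B) ((M : ℝ) / (b : ℝ) ^ (i + 1)) *
          phi (pbar σ) ((lam % (b * B) + v) / B) ((M : ℝ) / (b : ℝ) ^ (i + 1)))]
    refine sum_congr rfl fun u _ => ?_
    have hdiv : (u * b ^ (i + 1) + M) / b ^ (i + 1) = u := by
      rw [add_comm, Nat.add_mul_div_right _ _ (by positivity), Nat.div_eq_of_lt hM, zero_add]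
    have hx : ((u * b ^ (i + 1) + M : ℕ) : ℝ) / (b : ℝ) ^ (i + 1) =
        u + (M : ℝ) / (b : ℝ) ^ (i + 1) := by
      push_cast
      field_simp
    rw [hdiv, hx, phi_nat_add, phi_nat_add]
  have hpow' : b ^ n = b ^ i * (b * B) := by
    rw [hBdef, ← pow_succ', ← pow_add]
    congr 1
    omega
  rw [sum_congr rfl hval, sum_comm, mul_sum]
  refine sum_congr rfl fun M _ => ?_
  have hmod : ∀ a, ∀ L ∈ range (b * B), (a * (b * B) + L) % (b * B) = L := fun a L hL => by
    rw [add_comm, Nat.add_mul_mod_self_right, Nat.mod_eq_of_lt (mem_range.1 hL)]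
  rw [hpow', sum_range_mul_eq, sum_congr rfl fun a _ => sum_congr rfl fun L hL => by
    rw [hmod a L hL]]
  rw [sum_const, card_range, nsmul_eq_mul, sum_carry
    (fun h => phi σ h ((M : ℝ) / (b : ℝ) ^ (i + 1)))
    (fun h => phi (pbar σ) h ((M : ℝ) / (b : ℝ) ^ (i + 1))) (phi_zero σ _) (phi_self hb σ _),
    phiT1_eq hb, phiT2_eq hb, phiT]
  push_cast
  ring

/-- The contribution of a single digit position, in closed form. -/
lemma sum_phi_eps_eq {b n i : ℕ} (hb : 0 < b) (hi : i < n) (σ : Equiv.Perm (Fin b))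
    (S : Fin n → Equiv.Perm (Fin b)) :
    ∑ lam ∈ Icc 1 (b ^ n), ∑ N ∈ Icc 1 (b ^ n),
        phi σ (eps b n S lam N (i + 1)) ((N : ℝ) / (b : ℝ) ^ (i + 1)) *
          phi (pbar σ) (eps b n (fun k => pbar (S k)) lam N (i + 1))
            ((N : ℝ) / (b : ℝ) ^ (i + 1)) =
      ((b ^ (n - (i + 1)) : ℕ) + 2 * hingeSum (b ^ (n - (i + 1)))) *
          (((b : ℝ) ^ (i + 1)) ^ 2 * PhiT σ +
            1 / 6 * (hingeSum b - (b - 1) * (2 * b - 1) / 6)) +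
        ((b ^ (n - (i + 1)) : ℕ) * ((b ^ (n - (i + 1)) : ℕ) - 1) / 2 -
            hingeSum (b ^ (n - (i + 1)))) *
          (((b : ℝ) ^ (i + 1)) ^ 2 * (PhiT1 σ + PhiT2 σ) +
            1 / 3 * (b * (b - 1) / 2 - hingeSum b - (b - 1) * (b + 1) / 3)) := by
  have hb' : (b : ℝ) ≠ 0 := by positivity
  have hm : 0 < b ^ i := by positivity
  have hcast : (b : ℝ) ^ (i + 1) = b * (b ^ i : ℕ) := by push_cast; ring
  rw [sum_phi_eps hb hi, sum_add_distrib, ← mul_sum, ← mul_sum, sum_add_distrib]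
  rw [hcast, pow_succ' b i, sum_phiT hb σ hm, sum_phiT1 hb σ hm, sum_phiT2 hb σ hm]
  push_cast
  field_simp
  ring

lemma hingeSum_of_even {B : ℕ} (h : Even B) : hingeSum B = (B : ℝ) ^ 2 / 4 - B / 2 := by
  obtain ⟨m, rfl⟩ := even_iff_exists_two_mul.1 h
  rw [hingeSum_even]
  push_cast
  ring

lemma hingeSum_of_odd {B : ℕ} (h : Odd B) : hingeSum B = ((B : ℝ) - 1) ^ 2 / 4 := by
  obtain ⟨m, rfl⟩ := h
  rw [hingeSum_odd]
  push_cast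
  ring

/-- The normalized contribution of a digit position whose tail length `B` is even. -/
lemma two_div_sq_mul_level_of_even {b B : ℕ} {X Z T T₁ T₂ : ℝ} (hZ : Z ≠ 0) (hB : Even B)
    (hb : Even b) (hBX : (B : ℝ) * X = Z) :
    2 / Z ^ 2 * ((B + 2 * hingeSum B) *
          (X ^ 2 * T + 1 / 6 * (hingeSum b - (b - 1) * (2 * b - 1) / 6)) +
        (B * (B - 1) / 2 - hingeSum B) *
          (X ^ 2 * (T₁ + T₂) + 1 / 3 * (b * (b - 1) / 2 - hingeSum b - (b - 1) * (b + 1) / 3))) =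
      (T + 1 / 2 * T₁ + 1 / 2 * T₂) - ((b : ℝ) ^ 2 - 1) / 36 * (1 / X ^ 2) := by
  subst hBX
  have hX : X ≠ 0 := right_ne_zero_of_mul hZ
  have hB' : (B : ℝ) ≠ 0 := left_ne_zero_of_mul hZ
  rw [hingeSum_of_even hB, hingeSum_of_even hb]
  field_simp
  ring

/-- The normalized contribution of a digit position whose tail length `B` is odd. -/
lemma two_div_sq_mul_level_of_odd {b B : ℕ} {X Z T T₁ T₂ : ℝ} (hZ : Z ≠ 0) (hB : Odd B)
    (hb : Odd b) (hBX : (B : ℝ) * X = Z) :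
    2 / Z ^ 2 * ((B + 2 * hingeSum B) *
          (X ^ 2 * T + 1 / 6 * (hingeSum b - (b - 1) * (2 * b - 1) / 6)) +
        (B * (B - 1) / 2 - hingeSum B) *
          (X ^ 2 * (T₁ + T₂) + 1 / 3 * (b * (b - 1) / 2 - hingeSum b - (b - 1) * (b + 1) / 3))) =
      (T + 1 / 2 * T₁ + 1 / 2 * T₂) - ((b : ℝ) ^ 2 - 1) / 36 * (1 / X ^ 2) +
        (T - 1 / 2 * T₁ - 1 / 2 * T₂) / Z ^ 2 * X ^ 2 := by
  subst hBX
  have hX : X ≠ 0 := right_ne_zero_of_mul hZ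
  have hB' : (B : ℝ) ≠ 0 := left_ne_zero_of_mul hZ
  rw [hingeSum_of_odd hB, hingeSum_of_odd hb]
  field_simp
  ring

lemma sum_inv_pow_sq {x : ℝ} (hx : 2 ≤ x) (n : ℕ) :
    ∑ i ∈ range n, 1 / (x ^ (i + 1)) ^ 2 = (1 - 1 / (x ^ n) ^ 2) / (x ^ 2 - 1) := by
  have h0 : x ≠ 0 := by positivity
  have h1 : x ^ 2 - 1 ≠ 0 := by nlinarith
  induction n with
  | zero => simp
  | succ n ih =>
    rw [sum_range_succ, ih, pow_succ]
    field_simp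
    ring

lemma sum_pow_sq {x : ℝ} (hx : 2 ≤ x) (n : ℕ) :
    ∑ i ∈ range n, (x ^ (i + 1)) ^ 2 = x ^ 2 * ((x ^ n) ^ 2 - 1) / (x ^ 2 - 1) := by
  have h0 : x ≠ 0 := by positivity
  have h1 : x ^ 2 - 1 ≠ 0 := by nlinarith
  induction n with
  | zero => simp
  | succ n ih =>
    rw [sum_range_succ, ih, pow_succ]
    field_simp
    ring

theorem stmt10 (b : ℕ) (hb : 2 ≤ b) (n : ℕ) (hn : 1 ≤ n) (σ : Equiv.Perm (Fin b))
    (S : Fin n → Equiv.Perm (Fin b))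
    (hS : ∀ i, S i = σ ∨ S i = pbar σ) :
    (Even b →
      (2 / (b : ℝ) ^ (2 * n)) *
          ∑ j : Fin n, ∑ lam ∈ Finset.Icc 1 (b ^ n), ∑ N ∈ Finset.Icc 1 (b ^ n),
            phi σ (eps b n S lam N ((j : ℕ) + 1)) ((N : ℝ) / (b : ℝ) ^ ((j : ℕ) + 1)) *
              phi (pbar σ) (eps b n (fun i => pbar (S i)) lam N ((j : ℕ) + 1))
                ((N : ℝ) / (b : ℝ) ^ ((j : ℕ) + 1)) =
        (n : ℝ) * (PhiT σ + (1 / 2) * PhiT1 σ + (1 / 2) * PhiT2 σ)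
          + (PhiT σ - (1 / 2) * PhiT1 σ - (1 / 2) * PhiT2 σ)
          - 1 / 36 - 1 / (18 * (b : ℝ) ^ (2 * n)))
      ∧ (¬ Even b →
        (2 / (b : ℝ) ^ (2 * n)) *
            ∑ j : Fin n, ∑ lam ∈ Finset.Icc 1 (b ^ n), ∑ N ∈ Finset.Icc 1 (b ^ n),
              phi σ (eps b n S lam N ((j : ℕ) + 1)) ((N : ℝ) / (b : ℝ) ^ ((j : ℕ) + 1)) *
                phi (pbar σ) (eps b n (fun i => pbar (S i)) lam N ((j : ℕ) + 1))
                  ((N : ℝ) / (b : ℝ) ^ ((j : ℕ) + 1)) =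
          (n : ℝ) * (PhiT σ + (1 / 2) * PhiT1 σ + (1 / 2) * PhiT2 σ)
            + (-(1 / 36) + ((b : ℝ) ^ 2 / ((b : ℝ) ^ 2 - 1)) *
                  (PhiT σ - (1 / 2) * PhiT1 σ - (1 / 2) * PhiT2 σ)) *
                (1 - 1 / (b : ℝ) ^ (2 * n))) := by
  have hb0 : 0 < b := by omega
  have hbR : (2 : ℝ) ≤ b := by exact_mod_cast hb
  have hb' : (b : ℝ) ≠ 0 := by positivity
  have hb1 : (b : ℝ) ^ 2 - 1 ≠ 0 := by nlinarith
  have hZ : (b : ℝ) ^ n ≠ 0 := by positivity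
  have hterm := fun (j : Fin n) => sum_phi_eps_eq hb0 j.isLt σ S
  have hBX : ∀ i < n, ((b ^ (n - (i + 1)) : ℕ) : ℝ) * (b : ℝ) ^ (i + 1) = (b : ℝ) ^ n := by
    intro i hi
    push_cast
    rw [← pow_add]
    congr 1
    omega
  have hgeom := sum_inv_pow_sq hbR n
  have hgeom' := sum_pow_sq hbR n
  simp only [hterm]
  rw [pow_mul', Fin.sum_univ_eq_sum_range (fun i =>
    ((b ^ (n - (i + 1)) : ℕ) + 2 * hingeSum (b ^ (n - (i + 1)))) *
          (((b : ℝ) ^ (i + 1)) ^ 2 * PhiT σ +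
            1 / 6 * (hingeSum b - (b - 1) * (2 * b - 1) / 6)) +
        ((b ^ (n - (i + 1)) : ℕ) * ((b ^ (n - (i + 1)) : ℕ) - 1) / 2 -
            hingeSum (b ^ (n - (i + 1)))) *
          (((b : ℝ) ^ (i + 1)) ^ 2 * (PhiT1 σ + PhiT2 σ) +
            1 / 3 * (b * (b - 1) / 2 - hingeSum b - (b - 1) * (b + 1) / 3))), mul_sum]
  constructor
  · intro heven
    obtain ⟨k, rfl⟩ : ∃ k, n = k + 1 := ⟨n - 1, by omega⟩
    rw [sum_range_succ, sum_congr rfl fun i hi => two_div_sq_mul_level_of_even hZ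
      (heven.pow_of_ne_zero (by have := mem_range.1 hi; omega)) heven
      (hBX i (by have := mem_range.1 hi; omega))]
    rw [sum_range_succ] at hgeom
    rw [Nat.sub_self, pow_zero, hingeSum_of_even heven, sum_sub_distrib, ← mul_sum,
      eq_sub_of_add_eq hgeom,
      sum_const, card_range, nsmul_eq_mul]
    have h1 : hingeSum 1 = 0 := by simp [hingeSum]
    rw [h1]
    push_cast
    generalize (b : ℝ) ^ (k + 1) = Z at hZ ⊢
    field_simp
    ring
  · intro hodd
    have hodd := Nat.not_even_iff_odd.1 hodd
    rw [sum_congr rfl fun i hi => two_div_sq_mul_level_of_odd hZ hodd.pow hodd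
      (hBX i (mem_range.1 hi)),
      sum_add_distrib, sum_sub_distrib, ← mul_sum, ← mul_sum, hgeom, hgeom',
      sum_const, card_range, nsmul_eq_mul]
    generalize (b : ℝ) ^ n = Z at hZ ⊢
    field_simp
    ring

end SymHamm
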